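/- arXiv:1105.3575 — 3 statements merged into one kernel-verified Lean document; each statement's English description precedes it below -/
import Mathlib

section
/- Let [A,B] ⊂ ℝ be a compact interval and let w_0, w_1, …, w_k : [A,B] → ℝ be k-times continuously differentiable functions. Define u_0(x) = w_0(x) and, for 1 ≤ j ≤ k, u_j(x) = w_0(x) ∫_A^x w_1(t_1) ∫_A^{t_1} w_2(t_2) ⋯ ∫_A^{t_{j−1}} w_j(t_j) dt_j ⋯ dt_1 (the j-fold iterated integral). Then for every x ∈ [A,B] the Wronskian determinant W_x(u_0, …, u_k) = det( u_i^{(m)}(x) )_{i,m = 0,…,k} equals w_0(x)^{k+1} · w_1(x)^k · w_2(x)^{k−1} ⋯ w_{k−1}(x)^2 · w_k(x). -/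
open Finset Matrix intervalIntegral

/-- The iterated integral `x ↦ ∫_A^x w 0 (t₁) ∫_A^{t₁} w 1 (t₂) ⋯ ∫_A^{t_{j-1}} w (j-1) (t_j) dt_j ⋯ dt₁`. -/
noncomputable def iterInt (A : ℝ) : ℕ → (ℕ → ℝ → ℝ) → ℝ → ℝ
  | 0, _, _ => 1
  | j + 1, w, x => ∫ t in A..x, w 0 t * iterInt A j (fun i => w (i + 1)) t

/-- Part one of the fundamental theorem of calculus, within a compact interval. -/
theorem hasDerivWithinAt_integral_of_continuousOn_Icc {A B : ℝ} {f : ℝ → ℝ}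
    (hf : ContinuousOn f (Set.Icc A B)) {x : ℝ} (hx : x ∈ Set.Icc A B) :
    HasDerivWithinAt (fun y => ∫ t in A..y, f t) (f x) (Set.Icc A B) x := by
  have : Fact (x ∈ Set.Icc A B) := ⟨hx⟩
  refine integral_hasDerivWithinAt_right ?_
    (hf.stronglyMeasurableAtFilter_nhdsWithin measurableSet_Icc x) (hf x hx)
  refine (hf.mono ?_).intervalIntegrable
  rw [Set.uIcc_of_le hx.1]
  exact Set.Icc_subset_Icc_right hx.2

theorem contDiffOn_integral_Icc {A B : ℝ} (hAB : A < B) {n : ℕ} {f : ℝ → ℝ}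
    (hf : ContDiffOn ℝ n f (Set.Icc A B)) :
    ContDiffOn ℝ n (fun y => ∫ t in A..y, f t) (Set.Icc A B) := by
  have hderiv := fun y (hy : y ∈ Set.Icc A B) =>
    hasDerivWithinAt_integral_of_continuousOn_Icc hf.continuousOn hy
  have hsucc : ContDiffOn ℝ (n + 1) (fun y => ∫ t in A..y, f t) (Set.Icc A B) := by
    rw [contDiffOn_succ_iff_derivWithin (uniqueDiffOn_Icc hAB)]
    exact ⟨fun y hy => (hderiv y hy).differentiableWithinAt, by simp,
      hf.congr fun y hy => (hderiv y hy).derivWithin (uniqueDiffOn_Icc hAB y hy)⟩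
  exact hsucc.of_le (by exact_mod_cast n.le_succ)

theorem contDiffOn_iterInt {A B : ℝ} (hAB : A < B) {n : ℕ} (j : ℕ) (w : ℕ → ℝ → ℝ)
    (hw : ∀ i < j, ContDiffOn ℝ n (w i) (Set.Icc A B)) :
    ContDiffOn ℝ n (iterInt A j w) (Set.Icc A B) := by
  induction j generalizing w with
  | zero => exact contDiffOn_const (c := 1)
  | succ j ih =>
    exact contDiffOn_integral_Icc hAB
      ((hw 0 j.succ_pos).mul (ih _ fun i hi => hw (i + 1) (Nat.succ_lt_succ hi)))

/-- Multiplying `n` functions by a common factor `g` multiplies their Wronskian by `g ^ n`. -/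
theorem det_iteratedDerivWithin_mul {s : Set ℝ} (hs : UniqueDiffOn ℝ s) {x : ℝ} (hx : x ∈ s)
    (n : ℕ) (g : ℝ → ℝ) (f : Fin n → ℝ → ℝ)
    (hg : ∀ m < n, ContDiffOn ℝ m g s) (hf : ∀ i, ∀ m < n, ContDiffOn ℝ m (f i) s) :
    (Matrix.of fun i m : Fin n => iteratedDerivWithin (m : ℕ) (g * f i) s x).det
      = g x ^ n * (Matrix.of fun i m : Fin n => iteratedDerivWithin (m : ℕ) (f i) s x).det := by
  let T : Matrix (Fin n) (Fin n) ℝ := Matrix.of fun l m =>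
    ((m : ℕ).choose l : ℝ) * iteratedDerivWithin ((m : ℕ) - l) g s x
  have hT : T.det = g x ^ n := by
    rw [Matrix.det_of_isUpperTriangular]
    · simp [T]
    · intro i j hij
      simp [T, Nat.choose_eq_zero_of_lt (show (j : ℕ) < i from hij)]
  rw [← hT, mul_comm, ← Matrix.det_mul]
  congr 1
  ext i m
  rw [Matrix.of_apply, mul_comm g, iteratedDerivWithin_mul hx hs (hf i m m.2 x hx) (hg m m.2 x hx),
    Matrix.mul_apply]
  simp only [T, Matrix.of_apply]
  rw [Fin.sum_univ_eq_sum_range (fun l => iteratedDerivWithin l (f i) s x *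
      (((m : ℕ).choose l : ℝ) * iteratedDerivWithin ((m : ℕ) - l) g s x))]
  refine Finset.sum_subset_zero_on_sdiff (Finset.range_mono m.2) ?_ ?_
  · intro l hl
    rw [Finset.mem_sdiff, Finset.mem_range, Finset.mem_range] at hl
    simp [Nat.choose_eq_zero_of_lt (show (m : ℕ) < l by omega)]
  · intro l _
    ring

/-- If the first function is constantly `1`, the Wronskian reduces to that of the derivatives of
the others. -/
theorem det_iteratedDerivWithin_one {s : Set ℝ} {x : ℝ} (n : ℕ) (f : ℕ → ℝ → ℝ)
    (hf : f 0 = fun _ => 1) :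
    (Matrix.of fun i m : Fin (n + 1) => iteratedDerivWithin (m : ℕ) (f i) s x).det
      = (Matrix.of fun i m : Fin n =>
          iteratedDerivWithin (m : ℕ) (derivWithin (f (i + 1)) s) s x).det := by
  rw [Matrix.det_succ_row_zero, Fin.sum_univ_succ]
  simp only [Matrix.of_apply, Fin.val_zero, hf, iteratedDerivWithin_const, Fin.val_succ]
  simp only [Nat.add_one_ne_zero, if_true, if_false, mul_zero, zero_mul, Finset.sum_const_zero,
    add_zero, pow_zero, one_mul]
  congr 1
  ext i m
  simp [iteratedDerivWithin_succ']

theorem det_iteratedDerivWithin_mul_iterInt {A B : ℝ} (hAB : A < B) {x : ℝ}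
    (hx : x ∈ Set.Icc A B) (k : ℕ) (w : ℕ → ℝ → ℝ)
    (hw : ∀ j ≤ k, ContDiffOn ℝ k (w j) (Set.Icc A B)) :
    (Matrix.of fun i m : Fin (k + 1) => iteratedDerivWithin (m : ℕ)
        (w 0 * iterInt A i fun j => w (j + 1)) (Set.Icc A B) x).det
      = ∏ j : Fin (k + 1), (w (j : ℕ) x) ^ (k + 1 - (j : ℕ)) := by
  have hs := uniqueDiffOn_Icc hAB
  induction k generalizing w with
  | zero => simp [iterInt]
  | succ k ih =>
    have hle {m : ℕ} (hm : m < k + 1 + 1) : (m : WithTop ℕ∞) ≤ ((k + 1 : ℕ) : WithTop ℕ∞) := by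
      exact_mod_cast Nat.lt_succ_iff.mp hm
    have hiter (i : ℕ) (hi : i ≤ k + 1) :
        ContDiffOn ℝ (k + 1 : ℕ) (iterInt A i fun j => w (j + 1)) (Set.Icc A B) :=
      contDiffOn_iterInt hAB i _ fun j hj => hw (j + 1) (by omega)
    rw [det_iteratedDerivWithin_mul hs hx (k + 1 + 1) (w 0)
        (fun i => iterInt A i fun j => w (j + 1))
        (fun m hm => (hw 0 (Nat.zero_le _)).of_le (hle hm))
        (fun i m hm => (hiter i (Nat.lt_succ_iff.mp i.2)).of_le (hle hm)),
      det_iteratedDerivWithin_one (k + 1) (fun i => iterInt A i fun j => w (j + 1)) rfl,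
      Fin.prod_univ_succ]
    congr 1
    simp only [Fin.val_succ, Nat.add_sub_add_right]
    rw [← ih (fun j => w (j + 1)) fun j hj => (hw (j + 1) (by omega)).of_le (hle (by omega))]
    congr 1
    ext i m
    refine iteratedDerivWithin_congr (fun y hy => ?_) hx
    refine (hasDerivWithinAt_integral_of_continuousOn_Icc ?_ hy).derivWithin (hs y hy)
    exact (hw 1 (by omega)).continuousOn.mul (contDiffOn_iterInt hAB i _ fun j hj =>
      hw (j + 1 + 1) (by omega)).continuousOn

theorem wronskian_of_iterated_integrals (A B : ℝ) (hAB : A < B) (k : ℕ)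
    (w : ℕ → ℝ → ℝ)
    (hw : ∀ j ≤ k, ContDiffOn ℝ k (w j) (Set.Icc A B))
    (u : ℕ → ℝ → ℝ)
    (hu0 : ∀ x, u 0 x = w 0 x)
    (hu : ∀ j, 1 ≤ j → j ≤ k → ∀ x, u j x = w 0 x * iterInt A j (fun i => w (i + 1)) x)
    (x : ℝ) (hx : x ∈ Set.Icc A B) :
    (Matrix.of fun i m : Fin (k + 1) =>
        iteratedDerivWithin (m : ℕ) (u (i : ℕ)) (Set.Icc A B) x).det
      = ∏ j : Fin (k + 1), (w (j : ℕ) x) ^ (k + 1 - (j : ℕ)) := by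
  rw [← det_iteratedDerivWithin_mul_iterInt hAB hx k w hw]
  congr 1
  ext i m
  rw [Matrix.of_apply, Matrix.of_apply]
  congr 1
  ext y
  rcases Nat.eq_zero_or_pos (i : ℕ) with hi | hi
  · simp [hi, hu0, iterInt]
  · exact hu i hi (Nat.lt_succ_iff.mp i.2) y
end

section
/- Let l and s be positive integers with s > l − 1, set p = l + s, and let Q be a real polynomial of degree s all of whose roots are real. Let [A,B] ⊂ ℝ be a compact interval. If all roots of Q are smaller than A, then the functions 1, x, x², …, x^{2p−2}, Q(x)⁴ form a Chebyshev system on [A,B]; if all roots of Q are larger than B, then the functions 1, x, x², …, x^{2p−2}, −Q(x)⁴ form a Chebyshev system on [A,B]. -/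
open Finset Matrix

/-- `u_0, …, u_{n-1}` is a Chebyshev system on `[A,B]`. -/
def IsChebyshev (A B : ℝ) (n : ℕ) (u : ℕ → ℝ → ℝ) : Prop :=
  ∀ x : Fin n → ℝ, (∀ i, x i ∈ Set.Icc A B) → StrictMono x →
    0 < (Matrix.of fun i j : Fin n => u i (x j)).det

open Polynomial in
/-- All coefficients up to the degree are strictly positive. -/
def HasPosCoeffs (F : ℝ[X]) : Prop :=
  ∀ i ≤ F.natDegree, 0 < F.coeff i

namespace HasPosCoeffs

open Polynomial

variable {F G : ℝ[X]}

lemma leadingCoeff_pos (hF : HasPosCoeffs F) : 0 < F.leadingCoeff :=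
  hF _ le_rfl

lemma ne_zero (hF : HasPosCoeffs F) : F ≠ 0 :=
  leadingCoeff_ne_zero.1 hF.leadingCoeff_pos.ne'

lemma coeff_nonneg (hF : HasPosCoeffs F) (i : ℕ) : 0 ≤ F.coeff i := by
  rcases le_or_gt i F.natDegree with h | h
  · exact (hF i h).le
  · exact (coeff_eq_zero_of_natDegree_lt h).ge

lemma C_of_pos {a : ℝ} (ha : 0 < a) : HasPosCoeffs (C a) := by
  intro i hi
  obtain rfl : i = 0 := by simpa using hi
  simpa using ha

lemma X_add_C_of_pos {a : ℝ} (ha : 0 < a) : HasPosCoeffs (X + C a) := by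
  intro i hi
  rw [natDegree_X_add_C] at hi
  interval_cases i <;> simp [coeff_X, coeff_C, ha]

lemma mul (hF : HasPosCoeffs F) (hG : HasPosCoeffs G) : HasPosCoeffs (F * G) := by
  intro i hi
  rw [natDegree_mul hF.ne_zero hG.ne_zero] at hi
  rw [coeff_mul]
  refine Finset.sum_pos' (fun p _ => mul_nonneg (hF.coeff_nonneg _) (hG.coeff_nonneg _))
    ⟨(min i F.natDegree, i - min i F.natDegree), ?_, ?_⟩
  · rw [Finset.HasAntidiagonal.mem_antidiagonal]; dsimp only; omega
  · exact mul_pos (hF _ (min_le_right _ _)) (hG _ (by omega))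

lemma pow (hF : HasPosCoeffs F) (n : ℕ) : HasPosCoeffs (F ^ n) := by
  induction n with
  | zero => simpa using C_of_pos one_pos
  | succ n ih => rw [pow_succ]; exact ih.mul hF

lemma prod {ι : Type*} (s : Finset ι) (f : ι → ℝ[X]) (hf : ∀ i, HasPosCoeffs (f i)) :
    HasPosCoeffs (∏ i ∈ s, f i) :=
  Finset.prod_induction f HasPosCoeffs (fun _ _ => mul) (by simpa using C_of_pos one_pos)
    fun i _ => hf i

lemma eval_pos (hF : HasPosCoeffs F) {y : ℝ} (hy : 0 ≤ y) : 0 < F.eval y := by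
  rw [eval_eq_sum_range]
  refine Finset.sum_pos' (fun i _ => mul_nonneg (hF.coeff_nonneg i) (pow_nonneg hy i))
    ⟨0, by simp, ?_⟩
  simpa using hF 0 (Nat.zero_le _)

lemma divByMonic_X_sub_C (hF : HasPosCoeffs F) (hd : 1 ≤ F.natDegree) {y : ℝ} (hy : 0 ≤ y) :
    HasPosCoeffs (F /ₘ (X - C y)) := by
  intro i hi
  rw [natDegree_divByMonic _ (monic_X_sub_C y), natDegree_X_sub_C] at hi
  rw [coeff_divByMonic_X_sub_C]
  refine Finset.sum_pos' (fun j _ => mul_nonneg (pow_nonneg hy _) (hF.coeff_nonneg j))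
    ⟨i + 1, by rw [Finset.mem_Icc]; omega, ?_⟩
  simpa using hF (i + 1) (by omega)

/-- A polynomial with positive coefficients has positive divided differences at nonnegative
nodes: its interpolant has full degree and positive leading coefficient. -/
lemma exists_interpolant {m : ℕ} (hF : HasPosCoeffs F) (hm : m ≤ F.natDegree)
    (y : Fin (m + 1) → ℝ) (hy : ∀ j, 0 ≤ y j) :
    ∃ P : ℝ[X], P.natDegree = m ∧ 0 < P.leadingCoeff ∧ ∀ j, P.eval (y j) = F.eval (y j) := by
  induction m generalizing F with
  | zero =>
    refine ⟨C (F.eval (y 0)), natDegree_C _, ?_, fun j => ?_⟩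
    · simpa using hF.eval_pos (hy 0)
    · rw [Fin.fin_one_eq_zero j, eval_C]
  | succ m ih =>
    obtain ⟨P, hPd, hPl, hP⟩ := ih (hF.divByMonic_X_sub_C (by omega) (hy 0))
      (by rw [natDegree_divByMonic _ (monic_X_sub_C _), natDegree_X_sub_C]; omega)
      (fun j => y j.succ) (fun j => hy _)
    have hdeg : ((X - C (y 0)) * P).natDegree = m + 1 := by
      rw [(monic_X_sub_C _).natDegree_mul' (leadingCoeff_ne_zero.1 hPl.ne'),
        natDegree_X_sub_C, hPd, add_comm]
    refine ⟨(X - C (y 0)) * P + C (F.eval (y 0)), ?_, ?_, fun j => ?_⟩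
    · rw [natDegree_add_C, hdeg]
    · rw [leadingCoeff_add_of_degree_lt', leadingCoeff_monic_mul (monic_X_sub_C _)]
      · exact hPl
      · exact degree_C_le.trans_lt (natDegree_pos_iff_degree_pos.1 (by omega))
    · have key := congrArg (eval (y j)) (modByMonic_add_div F (X - C (y 0)))
      rw [modByMonic_X_sub_C_eq_C_eval] at key
      cases j using Fin.cases with
      | zero => simp
      | succ j =>
        rw [← key]
        simp only [eval_add, eval_mul, hP]
        ring

end HasPosCoeffs

open Polynomial in
lemma det_pow_last_pos {m : ℕ} (x : Fin (m + 1) → ℝ) (hx : StrictMono x) (f : ℝ → ℝ)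
    (P : ℝ[X]) (hd : P.natDegree = m) (hl : 0 < P.leadingCoeff)
    (hP : ∀ j, f (x j) = P.eval (x j)) :
    0 < (Matrix.of fun i j : Fin (m + 1) =>
      if (i : ℕ) = m then f (x j) else x j ^ (i : ℕ)).det := by
  have hM : (Matrix.of fun i j : Fin (m + 1) => if (i : ℕ) = m then f (x j) else x j ^ (i : ℕ)) =
      (vandermonde x)ᵀ.updateRow (Fin.last m)
        (∑ k : Fin (m + 1), P.coeff k • (vandermonde x)ᵀ k) := by
    ext i j
    cases i using Fin.lastCases with
    | last =>
      simp only [of_apply, Fin.val_last, if_true, updateRow_self, Finset.sum_apply, Pi.smul_apply,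
        transpose_apply, vandermonde_apply, smul_eq_mul, hP, eval_eq_sum_range, hd]
      exact (Fin.sum_univ_eq_sum_range (fun k => P.coeff k * x j ^ k) (m + 1)).symm
    | cast i =>
      rw [updateRow_ne (Fin.castSucc_lt_last i).ne]
      simp [vandermonde_apply, i.isLt.ne]
  rw [hM, det_updateRow_sum, det_transpose, det_vandermonde, smul_eq_mul, Fin.val_last]
  refine mul_pos (by rwa [← hd]) (Finset.prod_pos fun i _ => Finset.prod_pos fun j hj => ?_)
  exact sub_pos.2 (hx (Finset.mem_Ioi.1 hj))

open Polynomial in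
/-- The fourth power of a real-rooted polynomial with negative roots, up to a constant. -/
lemma exists_hasPosCoeffs {s : ℕ} {c : ℝ} (hc : c ≠ 0) (b : Fin s → ℝ) (hb : ∀ i, 0 < b i) :
    ∃ F : ℝ[X], HasPosCoeffs F ∧ F.natDegree = 4 * s ∧
      ∀ y, F.eval y = (c * ∏ i, (y + b i)) ^ 4 := by
  refine ⟨C (c ^ 4) * (∏ i, (X + C (b i))) ^ 4, ?_, ?_, fun y => ?_⟩
  · exact (HasPosCoeffs.C_of_pos (by positivity)).mul
      ((HasPosCoeffs.prod _ _ fun i => .X_add_C_of_pos (hb i)).pow 4)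
  · rw [natDegree_C_mul (pow_ne_zero 4 hc), natDegree_pow,
      natDegree_prod_of_monic _ _ fun i _ => monic_X_add_C _]
    simp
  · simp [eval_prod, mul_pow]

open Polynomial in
theorem rational_model_chebyshev (l s : ℕ) (hl : 1 ≤ l) (hs : 1 ≤ s) (hls : l - 1 < s)
    (A B : ℝ) (hAB : A ≤ B)
    (c : ℝ) (hc : c ≠ 0) (α : Fin s → ℝ)
    (Q : ℝ → ℝ) (hQ : ∀ x, Q x = c * ∏ i, (x - α i)) :
    ((∀ i, α i < A) →
      IsChebyshev A B (2 * (l + s))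
        (fun i x => if i = 2 * (l + s) - 1 then (Q x) ^ 4 else x ^ i)) ∧
    ((∀ i, B < α i) →
      IsChebyshev A B (2 * (l + s))
        (fun i x => if i = 2 * (l + s) - 1 then -((Q x) ^ 4) else x ^ i)) := by
  obtain ⟨m, hm⟩ : ∃ m, 2 * (l + s) = m + 1 := ⟨2 * (l + s) - 1, by omega⟩
  rw [hm, Nat.add_sub_cancel]
  have hm_le : m ≤ 4 * s := by omega
  have hodd : Odd m := ⟨l + s - 1, by omega⟩
  refine ⟨fun hα x hxI hx => ?_, fun hα x hxI hx => ?_⟩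
  · obtain ⟨F, hF, hFd, hFe⟩ := exists_hasPosCoeffs hc (fun i => A - α i)
      fun i => sub_pos.2 (hα i)
    obtain ⟨P, hPd, hPl, hP⟩ := hF.exists_interpolant (hFd ▸ hm_le) (fun j => x j - A)
      fun j => sub_nonneg.2 (hxI j).1
    refine det_pow_last_pos x hx (fun t => Q t ^ 4) (P.comp (X - C A)) ?_ ?_ fun j => ?_
    · rw [natDegree_comp, natDegree_X_sub_C, mul_one, hPd]
    · rw [leadingCoeff_comp (by simp), leadingCoeff_X_sub_C, one_pow, mul_one]
      exact hPl
    · simp [hP, hFe, hQ]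
  · obtain ⟨F, hF, hFd, hFe⟩ := exists_hasPosCoeffs hc (fun i => α i - B)
      fun i => sub_pos.2 (hα i)
    obtain ⟨P, hPd, hPl, hP⟩ := hF.exists_interpolant (hFd ▸ hm_le) (fun j => B - x j)
      fun j => sub_nonneg.2 (hxI j).2
    have hlin : C B - X = -(X - C B) := by ring
    refine det_pow_last_pos x hx (fun t => -(Q t ^ 4)) (-P.comp (C B - X)) ?_ ?_ fun j => ?_
    · rw [natDegree_neg, natDegree_comp, hlin, natDegree_neg, natDegree_X_sub_C, mul_one, hPd]
    · rw [leadingCoeff_neg, hlin,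
        leadingCoeff_comp (by rw [natDegree_neg, natDegree_X_sub_C]; exact one_ne_zero), leadingCoeff_neg,
        leadingCoeff_X_sub_C, hPd, hodd.neg_one_pow]
      simpa using hPl
    · have hprod : (∏ i, (α i - x j)) ^ 4 = (∏ i, (x j - α i)) ^ 4 := by
        rw [← Finset.prod_pow, ← Finset.prod_pow]
        exact Finset.prod_congr rfl fun i _ => by ring
      simp [hP, hFe, hQ, mul_pow, hprod]
end

section
/- Let n and j be integers with 1 ≤ j ≤ n, let λ(x) = (1+x)^{−n} and g(x) = (1+x)^{−(n+2)} for x > −1, and define f(x) = (d/dx)(λ(x) · x^{j−1}) / g(x). Then f coincides on (−1, ∞) with the polynomial ((j−1)x^{j−2}(1+x) − n x^{j−1})(1+x) of degree j, and its j-th derivative is the constant j! · (j − 1 − n), which is nonzero; in particular (d/dx)^j ( (d/dx)(λ(x)x^{j−1}) / g(x) ) is a nonzero constant on (−1, ∞). -/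
theorem Polynomial.iterate_deriv_eval {𝕜 : Type*} [NontriviallyNormedField 𝕜]
    (P : Polynomial 𝕜) (k : ℕ) :
    deriv^[k] (fun x => P.eval x) = fun x => (Polynomial.derivative^[k] P).eval x := by
  induction k generalizing P with
  | zero => rfl
  | succ k ih =>
    have h : (deriv fun x => P.eval x) = fun x => (Polynomial.derivative P).eval x :=
      by ext x; exact P.deriv
    rw [Function.iterate_succ_apply, Function.iterate_succ_apply, h, ih]

theorem Polynomial.iterate_derivative_of_natDegree_le {R : Type*} [Semiring R]
    (P : Polynomial R) (k : ℕ) (h : P.natDegree ≤ k) :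
    Polynomial.derivative^[k] P = Polynomial.C ((k.factorial : R) * P.coeff k) := by
  ext m
  rw [Polynomial.coeff_iterate_derivative, Polynomial.coeff_C]
  split_ifs with hm
  · simp [hm, Nat.descFactorial_self]
  · rw [Polynomial.coeff_eq_zero_of_natDegree_lt (by omega), smul_zero]

theorem weighted_polynomial_derivative_constant (n j : ℕ) (hj : 1 ≤ j) (hjn : j ≤ n)
    (lam g f : ℝ → ℝ)
    (hlam : ∀ x, lam x = ((1 + x) ^ n)⁻¹)
    (hg : ∀ x, g x = ((1 + x) ^ (n + 2))⁻¹)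
    (hf : ∀ x, f x = deriv (fun y => lam y * y ^ (j - 1)) x / g x) :
    (∀ x, -1 < x →
        f x = (((j : ℝ) - 1) * x ^ (j - 2) * (1 + x) - (n : ℝ) * x ^ (j - 1)) * (1 + x)) ∧
    (∀ x, -1 < x →
        iteratedDeriv j f x = (Nat.factorial j : ℝ) * ((j : ℝ) - 1 - (n : ℝ))) ∧
    (Nat.factorial j : ℝ) * ((j : ℝ) - 1 - (n : ℝ)) ≠ 0 := by
  have formula : ∀ x, -1 < x →
      f x = (((j : ℝ) - 1) * x ^ (j - 2) * (1 + x) - (n : ℝ) * x ^ (j - 1)) * (1 + x) := by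
    intro x hx
    have hx0 : (1 + x) ≠ 0 := by linarith
    obtain ⟨m, rfl⟩ : ∃ m, n = m + 1 := ⟨n - 1, by omega⟩
    have hpow : HasDerivAt (fun y : ℝ => (1 + y) ^ (m + 1)) (((m + 1 : ℕ) : ℝ) * (1 + x) ^ m) x := by
      exact (((hasDerivAt_id x).const_add 1).pow (m + 1)).congr_deriv (by simp)
    have hmul := (hpow.inv (pow_ne_zero _ hx0)).mul (hasDerivAt_pow (j - 1) x)
    have hfun : (fun y => lam y * y ^ (j - 1)) =
        (fun y : ℝ => (1 + y) ^ (m + 1))⁻¹ * fun y => y ^ (j - 1) := by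
      funext y
      simp [hlam]
    rw [hf, hg, hfun, hmul.deriv, show j - 1 - 1 = j - 2 by omega, Nat.cast_sub hj]
    simp only [Pi.inv_apply]
    field_simp
    push_cast
    ring
  refine ⟨formula, fun x hx => ?_, ?_⟩
  · let P : Polynomial ℝ := (.C ((j : ℝ) - 1) * .X ^ (j - 2) * (1 + .X) - .C (n : ℝ) * .X ^ (j - 1))
      * (1 + .X)
    have hP : f =ᶠ[nhds x] fun y => P.eval y := by
      filter_upwards [lt_mem_nhds hx] with y hy
      rw [formula y hy]
      simp [P]
    have key : P.natDegree ≤ j ∧ P.coeff j = (j : ℝ) - 1 - n := by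
      obtain rfl | ⟨k, rfl⟩ : j = 1 ∨ ∃ k, j = k + 2 := by
        by_cases h : j = 1
        · exact .inl h
        · exact .inr ⟨j - 2, by omega⟩
      · have hQ : P = .C (-(n : ℝ)) * .X + .C (-(n : ℝ)) := by
          simp [P]
          ring
        rw [hQ]
        constructor
        · compute_degree
        · simp
      · have hQ : P = .C ((k : ℝ) + 1 - n) * .X ^ (k + 2) + .C (2 * ((k : ℝ) + 1) - n) * .X ^ (k + 1)
            + .C ((k : ℝ) + 1) * .X ^ k := by
          have hC : Polynomial.C (2 : ℝ) = 2 := rfl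
          simp [P, hC]
          ring
        rw [hQ]
        constructor
        · compute_degree
        · simp only [Polynomial.coeff_add, Polynomial.coeff_C_mul, Polynomial.coeff_X_pow]
          simp
          ring
    simp only [hP.iteratedDeriv_eq, iteratedDeriv_eq_iterate, Polynomial.iterate_deriv_eval,
      Polynomial.iterate_derivative_of_natDegree_le P j key.1, Polynomial.eval_C, key.2]
  · have h : (j : ℝ) ≤ n := by exact_mod_cast hjn
    exact mul_ne_zero (by exact_mod_cast j.factorial_ne_zero) (by linarith)
end
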